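/- With the bigraded components H_{w,b}(X,Y) of the Hausdorff series (degree w in X, degree b in Y), the following w-recursion holds: (w+1) H_{w+1,b} = (1/2)[X, H_{w,b}] + Σ_{r≥1} (B_{2r}/(2r)!) Σ [H_{w_1,b_1},[...,[H_{w_{2r},b_{2r}}, X]...]], where the inner sum is over tuples with w_1+...+w_{2r} = w and b_1+...+b_{2r} = b, all (w_i,b_i) ≠ (0,0). -/

import Mathlib

namespace HausW
open PowerSeries Finset

section Core
variable {A : Type*} [Ring A] [Algebra ℚ A]

/-- series of order at least `M` -/
def I (A : Type*) [Ring A] [Algebra ℚ A] (M : ℕ) : Submodule ℚ (PowerSeries A) where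
  carrier := {p | ∀ n < M, coeff n p = 0}
  add_mem' := by
    intro a b ha hb n hn
    simp [ha n hn, hb n hn]
  zero_mem' := by intro n _; simp
  smul_mem' := by
    intro c a ha n hn
    have : coeff n (c • a) = c • coeff n a := rfl
    rw [this, ha n hn, smul_zero]

lemma mem_I {M : ℕ} {p : PowerSeries A} : p ∈ I A M ↔ ∀ n < M, coeff n p = 0 := Iff.rfl

lemma I_mono {M N : ℕ} (h : M ≤ N) {p : PowerSeries A} (hp : p ∈ I A N) : p ∈ I A M :=
  fun n hn => hp n (by omega)

lemma I_zero (p : PowerSeries A) : p ∈ I A 0 := fun n hn => by omega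

lemma I_mul {a b : ℕ} {p q : PowerSeries A} (hp : p ∈ I A a) (hq : q ∈ I A b) :
    p * q ∈ I A (a + b) := by
  intro n hn
  rw [coeff_mul]
  refine Finset.sum_eq_zero fun x hx => ?_
  rw [HasAntidiagonal.mem_antidiagonal] at hx
  by_cases h : x.1 < a
  · rw [hp _ h, zero_mul]
  · rw [hq x.2 (by omega), mul_zero]

lemma I_mul_left {b : ℕ} (p : PowerSeries A) {q : PowerSeries A} (hq : q ∈ I A b) :
    p * q ∈ I A b := by simpa using I_mul (I_zero p) hq

lemma I_mul_right {b : ℕ} (p : PowerSeries A) {q : PowerSeries A} (hq : q ∈ I A b) :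
    q * p ∈ I A b := by simpa using I_mul hq (I_zero p)

/-- commutator operator -/
noncomputable def adp (H : PowerSeries A) : Module.End ℚ (PowerSeries A) :=
  LinearMap.mulLeft ℚ H - LinearMap.mulRight ℚ H

lemma adp_apply (H v : PowerSeries A) : adp H v = H * v - v * H := rfl

lemma adp_mem {H v : PowerSeries A} (hH : H ∈ I A 1) {a : ℕ} (hv : v ∈ I A a) :
    adp H v ∈ I A (a + 1) := by
  rw [adp_apply]
  refine Submodule.sub_mem _ ?_ (I_mul hv hH)
  rw [add_comm]; exact I_mul hH hv

lemma adp_pow_mem {H v : PowerSeries A} (hH : H ∈ I A 1) {a : ℕ} (hv : v ∈ I A a) (k : ℕ) :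
    (adp H ^ k) v ∈ I A (a + k) := by
  induction k with
  | zero => simpa using hv
  | succ k ih =>
    rw [pow_succ', Module.End.mul_apply]
    exact adp_mem hH ih

lemma pow_mem_I {H : PowerSeries A} (hH : H ∈ I A 1) (k : ℕ) : H ^ k ∈ I A k := by
  induction k with
  | zero => exact I_zero _
  | succ k ih => rw [pow_succ]; exact I_mul ih hH

lemma triangle (M : ℕ) (t : ℕ → ℕ → PowerSeries A) (ht : ∀ k m, t k m ∈ I A (k + m)) :
    (∑ k ∈ range M, ∑ m ∈ range M, t k m)
      - ∑ n ∈ range M, ∑ p ∈ antidiagonal n, t p.1 p.2 ∈ I A M := by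
  have h1 : (∑ k ∈ range M, ∑ m ∈ range M, t k m)
      = ∑ p ∈ range M ×ˢ range M, t p.1 p.2 := by rw [sum_product]
  have h2 : ∑ n ∈ range M, ∑ p ∈ antidiagonal n, t p.1 p.2
      = ∑ p ∈ (range M ×ˢ range M).filter (fun p => p.1 + p.2 < M), t p.1 p.2 := by
    rw [← sum_fiberwise_of_maps_to (t := range M) (g := fun p : ℕ × ℕ => p.1 + p.2)]
    · refine sum_congr rfl fun n hn => sum_congr ?_ fun _ _ => rfl
      ext p
      simp only [HasAntidiagonal.mem_antidiagonal, mem_filter, mem_product, mem_range] at *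
      omega
    · intro p hp
      simp only [mem_filter, mem_range] at *
      exact hp.2
  rw [h1, h2, ← sum_filter_add_sum_filter_not _ (fun p : ℕ × ℕ => p.1 + p.2 < M), add_sub_cancel_left]
  refine Submodule.sum_mem _ fun p hp => I_mono ?_ (ht _ _)
  simp only [mem_filter] at hp
  omega

/-- truncated functional calculus of `ad H` -/
noncomputable def ev (H : PowerSeries A) (M : ℕ) (c : PowerSeries ℚ) :
    Module.End ℚ (PowerSeries A) := ∑ k ∈ range M, coeff k c • adp H ^ k

lemma ev_apply (H : PowerSeries A) (M : ℕ) (c : PowerSeries ℚ) (v : PowerSeries A) :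
    ev H M c v = ∑ k ∈ range M, coeff k c • (adp H ^ k) v := by
  simp [ev]

lemma ev_mem {H v : PowerSeries A} (hH : H ∈ I A 1) {a : ℕ} (hv : v ∈ I A a) (M : ℕ)
    (c : PowerSeries ℚ) : ev H M c v ∈ I A a := by
  rw [ev_apply]
  exact Submodule.sum_mem _ fun k _ => Submodule.smul_mem _ _
    (I_mono (by omega) (adp_pow_mem hH hv k))

lemma ev_one (H v : PowerSeries A) (M : ℕ) : ev H (M + 1) 1 v = v := by
  rw [ev_apply, sum_range_succ']
  simp [coeff_one]

lemma ev_mul {H : PowerSeries A} (hH : H ∈ I A 1) (v : PowerSeries A) (M : ℕ)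
    (c d : PowerSeries ℚ) : ev H M c (ev H M d v) - ev H M (c * d) v ∈ I A M := by
  have h := triangle M (fun k m => (coeff k c * coeff m d) • (adp H ^ (k + m)) v)
    (fun k m => Submodule.smul_mem _ _ (I_mono (by omega) (adp_pow_mem hH (I_zero v) _)))
  convert h using 2
  · rw [ev_apply, ev_apply]
    refine sum_congr rfl fun k _ => ?_
    rw [map_sum, smul_sum]
    refine sum_congr rfl fun m _ => ?_
    rw [map_smul, smul_smul, pow_add, Module.End.mul_apply]
  · rw [ev_apply]
    refine sum_congr rfl fun n _ => ?_
    rw [coeff_mul, sum_smul]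
    refine sum_congr rfl fun p hp => ?_
    rw [HasAntidiagonal.mem_antidiagonal.1 hp]

/-- divided powers -/
noncomputable def dp (H : PowerSeries A) (n : ℕ) : PowerSeries A := ((n.factorial : ℚ)⁻¹) • H ^ n

lemma dp_zero (H : PowerSeries A) : dp H 0 = 1 := by simp [dp]

lemma dp_succ (H : PowerSeries A) (n : ℕ) : ((n : ℚ) + 1) • dp H (n + 1) = H * dp H n := by
  have : (n.factorial : ℚ) ≠ 0 := by positivity
  have : (n : ℚ) + 1 ≠ 0 := by positivity
  rw [dp, dp, smul_smul, mul_smul_comm, ← pow_succ', Nat.factorial_succ]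
  congr 1
  push_cast
  field_simp

lemma dp_mem {H : PowerSeries A} (hH : H ∈ I A 1) (n : ℕ) : dp H n ∈ I A n :=
  Submodule.smul_mem _ _ (pow_mem_I hH n)

noncomputable def expT (H : PowerSeries A) (M : ℕ) : PowerSeries A := ∑ n ∈ range M, dp H n

noncomputable def phi : PowerSeries ℚ := PowerSeries.mk fun k => ((k + 1).factorial : ℚ)⁻¹

lemma smul_cancel {c : ℚ} (hc : c ≠ 0) {a b : PowerSeries A} (h : c • a = c • b) : a = b := by
  have := congrArg (fun z => c⁻¹ • z) h
  simpa [smul_smul, hc] using this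

/-- derivative of divided powers -/
lemma der_dp (H : PowerSeries A) (δ : PowerSeries A →ₗ[ℚ] PowerSeries A)
    (hδ : ∀ p q, δ (p * q) = δ p * q + p * δ q) (n : ℕ) :
    δ (dp H (n + 1)) = ∑ p ∈ antidiagonal n,
      (coeff p.1 phi • (adp H ^ p.1) (δ H)) * dp H p.2 := by
  set a : ℕ → PowerSeries A := fun k => coeff k phi • (adp H ^ k) (δ H) with ha
  have ha0 : a 0 = δ H := by simp [ha, phi]
  have has : ∀ k, adp H (a k) = ((k : ℚ) + 1 + 1) • a (k + 1) := by
    intro k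
    have h1 : ((k + 1).factorial : ℚ) ≠ 0 := by positivity
    have h3 : (k : ℚ) + 1 + 1 ≠ 0 := by positivity
    simp only [ha, map_smul, smul_smul, phi, coeff_mk]
    rw [pow_succ' (adp H) k, Module.End.mul_apply, Nat.factorial_succ (k + 1)]
    congr 1
    push_cast
    field_simp
  change _ = ∑ p ∈ HasAntidiagonal.antidiagonal n, a p.1 * dp H p.2
  induction n with
  | zero =>
    have : dp H (0 + 1) = H := by simp [dp]
    simp [this, dp_zero, ha0]
  | succ n ih =>
    have hn : ((n + 1 : ℕ) : ℚ) + 1 ≠ 0 := by positivity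
    apply smul_cancel hn
    rw [← map_smul, dp_succ, hδ, ih]
    have e1 : ∀ k m, H * (a k * dp H m) = ((k : ℚ) + 1 + 1) • (a (k + 1) * dp H m)
        + ((m : ℚ) + 1) • (a k * dp H (m + 1)) := by
      intro k m
      rw [← smul_mul_assoc, ← has, ← mul_smul_comm, dp_succ, adp_apply]
      noncomm_ring
    have e2 : ∀ q ∈ antidiagonal (n + 1), (((n + 1 : ℕ) : ℚ) + 1) • (a q.1 * dp H q.2)
        = ((q.1 : ℚ) + 1) • (a q.1 * dp H q.2) + (q.2 : ℚ) • (a q.1 * dp H q.2) := by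
      intro q hq
      rw [← add_smul]
      congr 1
      rw [← HasAntidiagonal.mem_antidiagonal.1 hq]
      push_cast; ring
    rw [smul_sum, sum_congr rfl e2, sum_add_distrib, mul_sum]
    rw [Finset.Nat.sum_antidiagonal_succ, Finset.Nat.sum_antidiagonal_succ' (n := n)]
    simp only [e1, sum_add_distrib, ha0]
    push_cast
    simp only [zero_smul, zero_add, one_smul]
    abel

/-- conjugation by divided powers -/
lemma conj_dp (H v : PowerSeries A) (n : ℕ) :
    dp H n * v = ∑ p ∈ antidiagonal n,
      (coeff p.1 (exp ℚ) • (adp H ^ p.1) v) * dp H p.2 := by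
  set a : ℕ → PowerSeries A := fun k => coeff k (exp ℚ) • (adp H ^ k) v with ha
  have ha0 : a 0 = v := by simp [ha]
  have has : ∀ k, adp H (a k) = ((k : ℚ) + 1) • a (k + 1) := by
    intro k
    have h1 : (k.factorial : ℚ) ≠ 0 := by positivity
    have h2 : (k : ℚ) + 1 ≠ 0 := by positivity
    simp only [ha, map_smul, smul_smul, coeff_exp]
    rw [pow_succ' (adp H) k, Module.End.mul_apply, Nat.factorial_succ k]
    congr 1
    simp
    field_simp
  change _ = ∑ p ∈ HasAntidiagonal.antidiagonal n, a p.1 * dp H p.2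
  induction n with
  | zero => simp [dp_zero, ha0]
  | succ n ih =>
    have hn : (n : ℚ) + 1 ≠ 0 := by positivity
    apply smul_cancel hn
    rw [← smul_mul_assoc, dp_succ, mul_assoc, ih]
    have e1 : ∀ k m, H * (a k * dp H m) = ((k : ℚ) + 1) • (a (k + 1) * dp H m)
        + ((m : ℚ) + 1) • (a k * dp H (m + 1)) := by
      intro k m
      rw [← smul_mul_assoc, ← has, ← mul_smul_comm, dp_succ, adp_apply]
      noncomm_ring
    have e2 : ∀ q ∈ antidiagonal (n + 1), ((n : ℚ) + 1) • (a q.1 * dp H q.2)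
        = (q.1 : ℚ) • (a q.1 * dp H q.2) + (q.2 : ℚ) • (a q.1 * dp H q.2) := by
      intro q hq
      rw [← add_smul]
      congr 1
      have := HasAntidiagonal.mem_antidiagonal.1 hq
      exact_mod_cast this.symm
    rw [smul_sum, sum_congr rfl e2, sum_add_distrib, mul_sum]
    rw [Finset.Nat.sum_antidiagonal_succ, Finset.Nat.sum_antidiagonal_succ' (n := n)]
    simp only [e1, sum_add_distrib, ha0]
    push_cast
    simp only [zero_smul, zero_add]

lemma ev_mul_expT {H v : PowerSeries A} (hH : H ∈ I A 1) (M : ℕ) (c : PowerSeries ℚ) :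
    ev H M c v * expT H M - ∑ n ∈ range M, ∑ p ∈ antidiagonal n,
      (coeff p.1 c • (adp H ^ p.1) v) * dp H p.2 ∈ I A M := by
  have h := triangle M (fun k m => (coeff k c • (adp H ^ k) v) * dp H m)
    (fun k m => I_mul (Submodule.smul_mem _ _ (I_mono (by omega) (adp_pow_mem hH (I_zero v) k)))
      (dp_mem hH m))
  convert h using 2
  rw [ev_apply, expT, sum_mul_sum]

lemma der_one (δ : PowerSeries A →ₗ[ℚ] PowerSeries A)
    (hδ : ∀ p q, δ (p * q) = δ p * q + p * δ q) : δ 1 = 0 := by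
  have := hδ 1 1
  simpa using this

lemma der_exp {H : PowerSeries A} (hH : H ∈ I A 1) (δ : PowerSeries A →ₗ[ℚ] PowerSeries A)
    (hδ : ∀ p q, δ (p * q) = δ p * q + p * δ q)
    (hI : ∀ M, ∀ p ∈ I A M, δ p ∈ I A M) (M : ℕ) :
    ev H M phi (δ H) * expT H M - δ (expT H M) ∈ I A M := by
  have h := ev_mul_expT (v := δ H) hH M phi
  have h2 : ∑ n ∈ range M, ∑ p ∈ antidiagonal n,
      (coeff p.1 phi • (adp H ^ p.1) (δ H)) * dp H p.2 = δ (expT H M) + δ (dp H M) := by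
    rw [← map_add, expT, ← sum_range_succ, sum_range_succ', map_add, dp_zero, der_one δ hδ, map_sum,
      add_zero]
    exact sum_congr rfl fun n _ => (der_dp H δ hδ n).symm
  rw [h2] at h
  have := Submodule.add_mem _ h (hI M _ (dp_mem hH M))
  convert this using 1
  abel

lemma conj_exp {H : PowerSeries A} (hH : H ∈ I A 1) (v : PowerSeries A) (M : ℕ) :
    ev H M (exp ℚ) v * expT H M - expT H M * v ∈ I A M := by
  have h := ev_mul_expT (v := v) hH M (exp ℚ)
  convert h using 2
  rw [expT, sum_mul]
  exact sum_congr rfl fun n _ => conj_dp H v n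

lemma X_mul_phi : (X : PowerSeries ℚ) * phi = exp ℚ - 1 := by
  ext n
  cases n with
  | zero => simp
  | succ n => simp [coeff_succ_X_mul, phi, coeff_exp, coeff_one]

lemma phi_mul_f : phi * bernoulliPowerSeries ℚ = 1 := by
  have h := bernoulliPowerSeries_mul_exp_sub_one ℚ
  rw [← X_mul_phi] at h
  apply mul_left_cancel₀ (X_ne_zero (R := ℚ))
  linear_combination h

lemma phi_mul_fneg : phi * evalNegHom (bernoulliPowerSeries ℚ) = exp ℚ := by
  have h := congrArg evalNegHom (bernoulliPowerSeries_mul_exp_sub_one ℚ)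
  simp only [map_mul, map_sub, map_one, evalNegHom_X] at h
  have h2 := exp_mul_exp_neg_eq_one (A := ℚ)
  have h3 := X_mul_phi
  apply mul_left_cancel₀ (X_ne_zero (R := ℚ))
  linear_combination (-exp ℚ) * h + evalNegHom (bernoulliPowerSeries ℚ) * h2 +
    evalNegHom (bernoulliPowerSeries ℚ) * h3

theorem core {H X' Y' : PowerSeries A} (hH : H ∈ I A 1) (hX : X' ∈ I A 1) (hY : Y' ∈ I A 1)
    (D P : PowerSeries A →ₗ[ℚ] PowerSeries A)
    (hD : ∀ p q, D (p * q) = D p * q + p * D q)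
    (hDc : ∀ p n, coeff n (D p) = (n : ℚ) • coeff n p)
    (hP : ∀ p q, P (p * q) = P p * q + p * P q)
    (hPI : ∀ M, ∀ p ∈ I A M, P p ∈ I A M)
    (hDP : ∀ p, D (P p) = P (D p))
    (hDX : D X' = X') (hPX : P X' = X') (hPY : P Y' = 0)
    (hDH : ∀ M, D H - (ev H M (bernoulliPowerSeries ℚ) X' +
      ev H M (evalNegHom (bernoulliPowerSeries ℚ)) Y') ∈ I A M) (M : ℕ) :
    P H - ev H M (bernoulliPowerSeries ℚ) X' ∈ I A M := by
  have hDI : ∀ M, ∀ p ∈ I A M, D p ∈ I A M := by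
    intro M p hp n hn
    rw [hDc, hp n hn, smul_zero]
  obtain _ | M := M
  · exact I_zero _
  set E := expT H (M + 1) with hE
  have hE1 : E - 1 ∈ I A 1 := by
    rw [hE, expT, sum_range_succ', dp_zero, add_sub_cancel_right]
    exact Submodule.sum_mem _ fun k _ => I_mono (by omega) (dp_mem hH (k + 1))
  set f := bernoulliPowerSeries ℚ with hf
  -- step a
  have a1 : D E - (X' * E + E * Y') ∈ I A (M + 1) := by
    have t1 := der_exp hH D hD hDI (M + 1)
    have t2 := I_mul_right E (ev_mem hH (hDH (M + 1)) (M + 1) phi)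
    have t3 := I_mul_right E (ev_mul hH X' (M + 1) phi f)
    have t4 := I_mul_right E (ev_mul hH Y' (M + 1) phi (evalNegHom f))
    have t5 := conj_exp hH Y' (M + 1)
    rw [phi_mul_f, ev_one] at t3
    rw [phi_mul_fneg] at t4
    rw [map_sub, map_add] at t2
    have := Submodule.add_mem _ (Submodule.add_mem _ (Submodule.add_mem _
      (Submodule.sub_mem _ t2 t1) t3) t4) t5
    convert this using 1
    rw [← hE]
    noncomm_ring
  set W := P E - X' * E with hW
  have b1 : D W - (X' * W + W * Y') ∈ I A (M + 1) := by
    have t1 := hPI _ _ a1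
    have t2 := I_mul_left X' a1
    have := Submodule.sub_mem _ t1 t2
    convert this using 1
    rw [map_sub P, map_add P, hP, hP, hPX, hPY, hW, map_sub D, hD, hDX, hDP]
    noncomm_ring
  have c0 : W ∈ I A 1 := by
    refine Submodule.sub_mem _ ?_ (I_mul_right _ hX)
    have := hPI _ _ hE1
    rwa [map_sub, der_one P hP, sub_zero] at this
  have c1 : ∀ j ≤ M, W ∈ I A (j + 1) := by
    intro j
    induction j with
    | zero => intro _; exact c0
    | succ j ih =>
      intro hj
      have hw := ih (by omega)
      have t1 : X' * W + W * Y' ∈ I A (j + 2) :=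
        Submodule.add_mem _ (I_mono (by omega : j + 2 ≤ 1 + (j + 1)) (I_mul hX hw)) (I_mono (by omega : j + 2 ≤ (j + 1) + 1) (I_mul hw hY))
      have t2 : D W ∈ I A (j + 2) := by
        have := Submodule.add_mem _ (I_mono (by omega : j + 2 ≤ M + 1) b1) t1
        simpa using this
      intro n hn
      by_cases hn0 : n = 0
      · exact c0 n (by omega)
      · have := t2 n hn
        rw [hDc] at this
        exact (smul_eq_zero.1 this).resolve_left (by exact_mod_cast hn0)
  have c2 := c1 M le_rfl
  have d1 : (ev H (M + 1) phi (P H) - X') * E ∈ I A (M + 1) := by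
    have := Submodule.add_mem _ (der_exp hH P hP hPI (M + 1)) c2
    convert this using 1
    rw [hW, ← hE]
    noncomm_ring
  have d2 : ∀ j ≤ M + 1, ev H (M + 1) phi (P H) - X' ∈ I A j := by
    intro j
    induction j with
    | zero => intro _; exact I_zero _
    | succ j ih =>
      intro hj
      have := Submodule.sub_mem _ (I_mono hj d1) (I_mul (ih (by omega)) hE1)
      convert this using 1
      noncomm_ring
  have e1 := ev_mem hH (d2 _ le_rfl) (M + 1) f
  have e2 := ev_mul hH (P H) (M + 1) f phi
  rw [mul_comm, phi_mul_f, ev_one] at e2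
  have := Submodule.sub_mem _ e1 e2
  convert this using 1
  rw [map_sub]
  abel

end Core
end HausW

namespace HausW
open PowerSeries Finset

/-- the free Lie algebra on two letters -/
abbrev L := FreeLieAlgebra ℚ Bool

lemma free_induction {P : L → Prop} (h0 : P 0) (hadd : ∀ a b, P a → P b → P (a + b))
    (hsmul : ∀ (c : ℚ) a, P a → P (c • a)) (hlie : ∀ a b, P a → P b → P ⁅a, b⁆)
    (hof : ∀ i, P (FreeLieAlgebra.of ℚ i)) (l : L) : P l := by
  let S : LieSubalgebra ℚ L :=
    { carrier := {l | P l}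
      add_mem' := fun {a b} ha hb => hadd a b ha hb
      zero_mem' := h0
      smul_mem' := fun c a ha => hsmul c a ha
      lie_mem' := fun {a b} ha hb => hlie a b ha hb }
  let F : L →ₗ⁅ℚ⁆ S := FreeLieAlgebra.lift ℚ (fun i => ⟨FreeLieAlgebra.of ℚ i, hof i⟩)
  have : S.incl.comp F = LieHom.id := by
    apply FreeLieAlgebra.hom_ext
    intro i
    simp [F]
  have h2 := LieHom.congr_fun this l
  have h3 : ((F l : S) : L) = l := h2
  rw [← h3]
  exact (F l).2

section Rep
attribute [local instance] LieRing.ofAssociativeRing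

/-- the operator of a generator on the extended adjoint module -/
noncomputable def op (a : Bool → ℚ) (i : Bool) : Module.End ℚ (L × ℚ) where
  toFun z := (⁅(FreeLieAlgebra.of ℚ i : L), z.1⁆ + (z.2 * a i) • FreeLieAlgebra.of ℚ i, 0)
  map_add' := by
    intro z z'
    ext <;> simp [add_mul, add_smul]
    abel
  map_smul' := by
    intro c z
    ext <;> simp [smul_smul, mul_assoc]

/-- the extended adjoint representation -/
noncomputable def rho (a : Bool → ℚ) : L →ₗ⁅ℚ⁆ Module.End ℚ (L × ℚ) :=
  FreeLieAlgebra.lift ℚ (op a)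

/-- the derivation with weights `a` -/
noncomputable def der (a : Bool → ℚ) : L →ₗ[ℚ] L where
  toFun l := (rho a l (0, 1)).1
  map_add' := by intro l m; simp
  map_smul' := by intro c m; simp

lemma der_apply (a : Bool → ℚ) (l : L) : der a l = (rho a l (0, 1)).1 := rfl

lemma rho_mul (a : Bool → ℚ) (l m : L) : rho a ⁅l, m⁆ = rho a l * rho a m - rho a m * rho a l := by
  rw [LieHom.map_lie]; rfl

lemma rho_apply (a : Bool → ℚ) (l : L) : ∀ z : L × ℚ, rho a l z = (⁅l, z.1⁆ + z.2 • der a l, 0) := by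
  induction l using free_induction with
  | h0 => intro z; simp; rfl
  | hadd p q hp hq =>
    intro z
    rw [map_add, LinearMap.add_apply, hp, hq, map_add]
    ext <;> simp
    abel
  | hsmul c p hp =>
    intro z
    rw [map_smul, LinearMap.smul_apply, hp, map_smul]
    ext <;> simp [smul_comm c z.2]
  | hlie p q hp hq =>
    intro z
    rw [der_apply, rho_mul]
    simp only [LinearMap.sub_apply, Module.End.mul_apply, hp, hq]
    ext
    · simp [smul_sub, lie_lie]
      abel
    · simp
  | hof i =>
    intro z
    rw [der_apply, rho, FreeLieAlgebra.lift_of_apply]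
    ext <;> simp [op, smul_smul]

lemma der_lie (a : Bool → ℚ) (l m : L) : der a ⁅l, m⁆ = ⁅der a l, m⁆ + ⁅l, der a m⁆ := by
  rw [der_apply, rho_mul]
  simp only [LinearMap.sub_apply, Module.End.mul_apply, rho_apply]
  simp
  rw [← lie_skew m (der a l)]
  abel

lemma der_of (a : Bool → ℚ) (i : Bool) :
    der a (FreeLieAlgebra.of ℚ i) = a i • FreeLieAlgebra.of ℚ i := by
  rw [der_apply, rho, FreeLieAlgebra.lift_of_apply]
  simp [op]

lemma der_comm (a b : Bool → ℚ) (l : L) : der a (der b l) = der b (der a l) := by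
  induction l using free_induction with
  | h0 => simp
  | hadd p q hp hq => simp [hp, hq]
  | hsmul c p hp => simp [hp]
  | hlie p q hp hq =>
    simp only [der_lie, map_add, hp, hq]
    abel
  | hof i => simp [der_of, smul_smul, mul_comm]

lemma indep (T : L →ₗ[ℚ] L) (s : Finset ℕ) (v : ℕ → L) (h : ∀ i ∈ s, T (v i) = (i : ℚ) • v i)
    (hs : ∑ i ∈ s, v i = 0) : ∀ i ∈ s, v i = 0 := by
  have h1 := (Module.End.eigenspaces_iSupIndep (T : Module.End ℚ L)).comp
    (f := fun i : ℕ => (i : ℚ)) Nat.cast_injective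
  rw [iSupIndep_iff_finsetSum_eq_zero_imp_eq_zero] at h1
  refine h1 s v (fun i hi => ?_) hs
  simp only [Function.comp]
  rw [Module.End.mem_eigenspace_iff]
  exact h i hi

/-- graded pieces -/
noncomputable def gr (a : Bool → ℕ) (σ : L →ₗ⁅ℚ⁆ L) (n : ℕ) : Submodule ℚ L where
  carrier := {l | der (fun i => (a i : ℚ)) l = (n : ℚ) • l ∧ σ l = (2 : ℚ) ^ n • l}
  add_mem' := by
    rintro p q ⟨h1, h2⟩ ⟨h3, h4⟩
    simp [h1, h2, h3, h4]
  zero_mem' := by simp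
  smul_mem' := by
    rintro c p ⟨h1, h2⟩
    constructor
    · rw [map_smul, h1, smul_comm]
    · rw [map_smul, h2, smul_comm]

lemma gr_top (a : Bool → ℕ) (σ : L →ₗ⁅ℚ⁆ L)
    (hσ : ∀ i, σ (FreeLieAlgebra.of ℚ i) = (2 : ℚ) ^ (a i) • FreeLieAlgebra.of ℚ i) (l : L) :
    l ∈ ⨆ n, gr a σ n := by
  induction l using free_induction with
  | h0 => exact Submodule.zero_mem _
  | hadd p q hp hq => exact Submodule.add_mem _ hp hq
  | hsmul c p hp => exact Submodule.smul_mem _ _ hp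
  | hlie p q hp hq =>
    induction hp using Submodule.iSup_induction' with
    | zero => simp
    | add x y _ _ hx hy => rw [add_lie]; exact Submodule.add_mem _ hx hy
    | mem i x hx =>
      induction hq using Submodule.iSup_induction' with
      | zero => simp
      | add x y _ _ hx hy => rw [lie_add]; exact Submodule.add_mem _ hx hy
      | mem j y hy =>
        refine Submodule.mem_iSup_of_mem (i + j) ⟨?_, ?_⟩
        · rw [der_lie, hx.1, hy.1, smul_lie, lie_smul, ← add_smul]
          push_cast; rfl
        · rw [LieHom.map_lie, hx.2, hy.2, smul_lie, lie_smul, smul_smul, pow_add]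
  | hof i => exact Submodule.mem_iSup_of_mem (a i) ⟨der_of _ _, hσ i⟩

lemma der_of_sigma (a : Bool → ℕ) (σ : L →ₗ⁅ℚ⁆ L)
    (hσ : ∀ i, σ (FreeLieAlgebra.of ℚ i) = (2 : ℚ) ^ (a i) • FreeLieAlgebra.of ℚ i) (l : L) (n : ℕ)
    (hl : σ l = (2 : ℚ) ^ n • l) : der (fun i => (a i : ℚ)) l = (n : ℚ) • l := by
  obtain ⟨f, hf, hs⟩ := (Submodule.mem_iSup_iff_exists_finsupp _ _).1 (gr_top a σ hσ l)
  rw [Finsupp.sum] at hs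
  have h1 : ∑ i ∈ f.support, ((2 : ℚ) ^ i - 2 ^ n) • f i = 0 := by
    have : ∑ i ∈ f.support, ((2 : ℚ) ^ i - 2 ^ n) • f i = σ l - (2 : ℚ) ^ n • l := by
      rw [← hs, map_sum, smul_sum, ← sum_sub_distrib]
      exact sum_congr rfl fun i _ => by rw [sub_smul, (hf i).2]
    rw [this, hl, sub_self]
  have h2 := indep (der (fun i => (a i : ℚ))) f.support _ (fun i _ => by
    rw [map_smul, (hf i).1, smul_comm]) h1
  rw [← hs, map_sum, smul_sum]
  refine sum_congr rfl fun i hi => ?_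
  rw [(hf i).1]
  rcases smul_eq_zero.1 (h2 i hi) with h | h
  · have : i = n := by
      have h3 : (2 : ℚ) ^ i = 2 ^ n := by linarith
      exact pow_right_injective₀ (by norm_num) (by norm_num) h3
    rw [this]
  · simp [h]

end Rep

section Comb
variable {ι : Type*} [AddCommMonoid ι] [HasAntidiagonal ι] [DecidableEq ι]

/-- iterated convolution brackets -/
noncomputable def K (G : ι → L) (x : L) : ℕ → ι → L
  | 0 => fun n => if n = 0 then x else 0
  | k + 1 => fun n => ∑ p ∈ HasAntidiagonal.antidiagonal n, ⁅G p.1, K G x k p.2⁆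

lemma K_tuple (G : ι → L) (x : L) (k : ℕ) : ∀ n,
    ∑ s ∈ finAntidiagonal k n, (List.ofFn s).foldr (fun m acc => ⁅G m, acc⁆) x = K G x k n := by
  induction k with
  | zero =>
    intro n
    by_cases h : n = 0
    · simp [finAntidiagonal, finAntidiagonal.aux, h, K]
    · simp [finAntidiagonal, finAntidiagonal.aux, h, K]
  | succ k ih =>
    intro n
    have : finAntidiagonal (k + 1) n = (finAntidiagonal.aux (k + 1) n).1 := rfl
    rw [this, finAntidiagonal.aux]
    simp only
    rw [sum_disjiUnion]
    simp only [K]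
    refine sum_congr rfl fun p _ => ?_
    rw [sum_map, ← ih, lie_sum]
    refine sum_congr rfl fun s _ => ?_
    simp [List.ofFn_succ]

lemma foldr_zero (G : ι → L) (x : L) (l : List ι) (h : ∃ m ∈ l, G m = 0) :
    l.foldr (fun m acc => ⁅G m, acc⁆) x = 0 := by
  induction l with
  | nil => simp at h
  | cons a l ih =>
    obtain ⟨m, hm, hG⟩ := h
    rcases List.mem_cons.1 hm with rfl | hm
    · simp [hG]
    · rw [List.foldr_cons, ih ⟨m, hm, hG⟩, lie_zero]

lemma K_filter (G : ι → L) (hG : G 0 = 0) (x : L) (k : ℕ) (n : ι) (S : Finset (Fin k → ι))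
    (hS : ∀ s, s ∈ S ↔ (∀ i, s i ≠ 0) ∧ ∑ i, s i = n) :
    ∑ s ∈ S, (List.ofFn s).foldr (fun m acc => ⁅G m, acc⁆) x = K G x k n := by
  rw [← K_tuple]
  refine sum_subset (fun s hs => ?_) (fun s hs hs' => ?_)
  · rw [mem_finAntidiagonal]; exact ((hS s).1 hs).2
  · rw [mem_finAntidiagonal] at hs
    rw [hS] at hs'
    have : ∃ i, s i = 0 := by
      by_contra hc
      push Not at hc
      exact hs' ⟨hc, hs⟩
    obtain ⟨i, hi⟩ := this
    exact foldr_zero G x _ ⟨s i, by simp, by rw [hi, hG]⟩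

lemma K_add (G : ι → L) (x y : L) (k : ℕ) : ∀ n, K G (x + y) k n = K G x k n + K G y k n := by
  induction k with
  | zero => intro n; simp only [K]; split_ifs <;> simp
  | succ k ih => intro n; simp [K, ih, sum_add_distrib]

lemma K_one (G : ι → L) (x : L) (n : ι) : K G x 1 n = ⁅G n, x⁆ := by
  simp only [K]
  rw [sum_eq_single (n, 0)]
  · simp
  · rintro ⟨a, b⟩ hab hne
    rw [HasAntidiagonal.mem_antidiagonal] at hab
    have : b ≠ 0 := by
      rintro rfl
      simp at hab
      exact hne (by rw [hab])
    simp [this]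
  · intro h
    exact absurd (HasAntidiagonal.mem_antidiagonal.2 (by simp)) h

lemma K_der (G : ι → L) (x : L) (a : Bool → ℚ) (ω : ι →+ ℚ) (hG : ∀ p, der a (G p) = ω p • G p)
    (c : ℚ) (hx : der a x = c • x) (k : ℕ) : ∀ n, der a (K G x k n) = (ω n + c) • K G x k n := by
  induction k with
  | zero =>
    intro n
    simp only [K]
    split_ifs with h
    · simp [h, hx]
    · simp
  | succ k ih =>
    intro n
    simp only [K, map_sum, smul_sum]
    refine sum_congr rfl fun p hp => ?_
    rw [der_lie, hG, ih, smul_lie, lie_smul, ← add_smul, ← HasAntidiagonal.mem_antidiagonal.1 hp,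
      map_add]
    congr 1
    ring

end Comb

lemma K_vanish (H : ℕ → L) (hH : H 0 = 0) (x : L) (k : ℕ) : ∀ n < k, K H x k n = 0 := by
  induction k with
  | zero => intro n h; omega
  | succ k ih =>
    intro n hn
    simp only [K]
    refine sum_eq_zero fun p hp => ?_
    have := HasAntidiagonal.mem_antidiagonal.1 hp
    by_cases h : p.1 = 0
    · rw [h, hH, zero_lie]
    · rw [ih _ (by omega), lie_zero]

instance instAntiProd : HasAntidiagonal (ℕ × ℕ) where
  antidiagonal n := (HasAntidiagonal.antidiagonal n.1 ×ˢ HasAntidiagonal.antidiagonal n.2).image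
    (fun q => ((q.1.1, q.2.1), (q.1.2, q.2.2)))
  mem_antidiagonal := by
    rintro ⟨n, m⟩ ⟨⟨a, b⟩, ⟨c, d⟩⟩
    simp

lemma K_split (H : ℕ → L) (G : ℕ × ℕ → L)
    (hHG : ∀ m, H m = ∑ q ∈ HasAntidiagonal.antidiagonal m, G q) (x : L) (k : ℕ) : ∀ n,
    K H x k n = ∑ q ∈ HasAntidiagonal.antidiagonal n, K G x k q := by
  induction k with
  | zero =>
    intro n
    simp only [K]
    by_cases h : n = 0
    · subst h; simp [Prod.ext_iff]
    · rw [if_neg h]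
      symm
      refine sum_eq_zero fun q hq => ?_
      rw [if_neg]
      rintro rfl
      have := HasAntidiagonal.mem_antidiagonal.1 hq
      simp at this
      omega
  | succ k ih =>
    intro n
    simp only [K]
    have e : ∀ p ∈ HasAntidiagonal.antidiagonal n, ⁅H p.1, K H x k p.2⁆
        = ∑ u ∈ HasAntidiagonal.antidiagonal p.1 ×ˢ HasAntidiagonal.antidiagonal p.2,
          ⁅G u.1, K G x k u.2⁆ := by
      intro p _
      rw [hHG, ih, sum_product, sum_lie]
      exact sum_congr rfl fun q _ => by rw [lie_sum]
    rw [sum_congr rfl e, sum_sigma', sum_sigma']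
    refine sum_nbij' (fun s => ⟨s.2.1 + s.2.2, s.2⟩)
      (fun s => ⟨(s.2.1.1 + s.2.1.2, s.2.2.1 + s.2.2.2), s.2⟩) ?_ ?_ ?_ ?_ ?_
    · rintro ⟨⟨p, p'⟩, ⟨⟨a, b⟩, ⟨c, d⟩⟩⟩ h
      simp only [mem_sigma, mem_product, HasAntidiagonal.mem_antidiagonal, Prod.mk_add_mk] at *
      exact ⟨by omega, trivial⟩
    · rintro ⟨⟨p, p'⟩, ⟨⟨a, b⟩, ⟨c, d⟩⟩⟩ h
      simp only [mem_sigma, mem_product, HasAntidiagonal.mem_antidiagonal, Prod.mk_add_mk,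
        Prod.mk.injEq] at *
      exact ⟨by omega, trivial, trivial⟩
    · rintro ⟨⟨p, p'⟩, ⟨⟨a, b⟩, ⟨c, d⟩⟩⟩ h
      simp only [mem_sigma, mem_product, HasAntidiagonal.mem_antidiagonal] at *
      obtain ⟨_, rfl, rfl⟩ := h
      rfl
    · rintro ⟨⟨p, p'⟩, ⟨⟨a, b⟩, ⟨c, d⟩⟩⟩ h
      simp only [mem_sigma, mem_product, HasAntidiagonal.mem_antidiagonal] at *
      obtain ⟨_, h⟩ := h
      rw [h]
    · rintro ⟨⟨p, p'⟩, ⟨⟨a, b⟩, ⟨c, d⟩⟩⟩ h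
      rfl

lemma coeff_f (k : ℕ) : coeff k (bernoulliPowerSeries ℚ) = bernoulli k / (k.factorial : ℚ) := by
  simp [bernoulliPowerSeries]

lemma coeff_fneg (k : ℕ) : coeff k (evalNegHom (bernoulliPowerSeries ℚ))
    = (-1) ^ k * (bernoulli k / (k.factorial : ℚ)) := by
  rw [evalNegHom, coeff_rescale, coeff_f]

lemma evenodd (g : ℕ → L) (N : ℕ) :
    ∑ k ∈ range (2 * N + 2), coeff k (bernoulliPowerSeries ℚ) • g k
      = g 0 - (1 / 2 : ℚ) • g 1 + ∑ r ∈ Finset.Icc 1 N,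
        (bernoulli (2 * r) / ((2 * r).factorial : ℚ)) • g (2 * r) := by
  induction N with
  | zero =>
    simp [sum_range_succ, coeff_f]
    rw [neg_div, neg_smul]; norm_num; abel
  | succ N ih =>
    rw [show 2 * (N + 1) + 2 = (2 * N + 2) + 1 + 1 by ring, sum_range_succ, sum_range_succ, ih,
      sum_Icc_succ_top (by omega), coeff_f, coeff_f,
      bernoulli_eq_zero_of_odd (n := 2 * N + 2 + 1) ⟨N + 1, by ring⟩ (by omega)]
    simp [mul_add, add_assoc]

lemma evenodd_neg (g : ℕ → L) (N : ℕ) :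
    ∑ k ∈ range (2 * N + 2), coeff k (evalNegHom (bernoulliPowerSeries ℚ)) • g k
      = g 0 + (1 / 2 : ℚ) • g 1 + ∑ r ∈ Finset.Icc 1 N,
        (bernoulli (2 * r) / ((2 * r).factorial : ℚ)) • g (2 * r) := by
  have h := evenodd (fun k => (-1 : ℚ) ^ k • g k) N
  simp only [smul_smul, coeff_f] at h
  simp only [coeff_fneg]
  simp only [mul_comm ((-1 : ℚ) ^ _)]
  rw [h]
  simp [pow_mul]

end HausW

namespace HausW
open PowerSeries Finset

section Final
attribute [local instance] LieRing.ofAssociativeRing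

/-- weights of total degree -/
def a11 : Bool → ℚ := fun _ => 1

/-- weights of the degree in the first letter -/
def a10 : Bool → ℚ := fun i => if i then 1 else 0

/-- coefficientwise image of a sequence -/
noncomputable def ser (g : ℕ → L) : PowerSeries (Module.End ℚ (L × ℚ)) :=
  PowerSeries.mk fun n => rho a11 (g n)

lemma adp_ser (h g : ℕ → L) : adp (ser h) (ser g)
    = ser (fun n => ∑ p ∈ HasAntidiagonal.antidiagonal n, ⁅h p.1, g p.2⁆) := by
  ext1 n
  rw [adp_apply, map_sub, coeff_mul, coeff_mul]
  rw [← Finset.Nat.sum_antidiagonal_swap (f := fun p => coeff p.1 (ser g) * coeff p.2 (ser h))]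
  rw [← sum_sub_distrib]
  simp only [ser, coeff_mk, map_sum]
  exact sum_congr rfl fun p _ => by rw [rho_mul]; rfl

lemma adp_ser_pow (h : ℕ → L) (x : L) (k : ℕ) :
    (adp (ser h) ^ k) (C (rho a11 x)) = ser (K h x k) := by
  induction k with
  | zero =>
    ext1 n
    simp only [pow_zero, Module.End.one_apply, ser, coeff_mk, K, coeff_C]
    split_ifs <;> simp
  | succ k ih =>
    rw [pow_succ', Module.End.mul_apply, ih, adp_ser]
    rfl

lemma adp_pow_mul_X {A : Type*} [Ring A] [Algebra ℚ A] (H v : PowerSeries A) (k : ℕ) :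
    (adp H ^ k) (v * X) = (adp H ^ k) v * X := by
  induction k with
  | zero => simp
  | succ k ih =>
    rw [pow_succ', Module.End.mul_apply, Module.End.mul_apply, ih, adp_apply, adp_apply, sub_mul,
      mul_assoc, mul_assoc, mul_assoc, (commute_X H).eq]

lemma coeff_ev_succ (h : ℕ → L) (x : L) (M n : ℕ) (c : PowerSeries ℚ) :
    coeff (n + 1) (ev (ser h) M c (C (rho a11 x) * X))
      = rho a11 (∑ k ∈ range M, coeff k c • K h x k n) := by
  rw [ev_apply, map_sum, map_sum]
  refine sum_congr rfl fun k _ => ?_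
  have : ∀ (c : ℚ) (p : PowerSeries (Module.End ℚ (L × ℚ))), coeff (n + 1) (c • p)
    = c • coeff (n + 1) p := fun _ _ => rfl
  rw [adp_pow_mul_X, adp_ser_pow, this, coeff_succ_mul_X, ser, coeff_mk]
  exact (map_smul (rho a11) _ _).symm

lemma coeff_ev_zero (h : ℕ → L) (h0 : h 0 = 0) (x : L) (M : ℕ) (c : PowerSeries ℚ) :
    coeff 0 (ev (ser h) M c (C (rho a11 x) * X)) = 0 := by
  rw [ev_apply, map_sum]
  refine sum_eq_zero fun k _ => ?_
  rw [adp_pow_mul_X]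
  have : ∀ (c : ℚ) (p : PowerSeries (Module.End ℚ (L × ℚ))), coeff 0 (c • p)
    = c • coeff 0 p := fun _ _ => rfl
  rw [this]
  simp

/-- truncation independence -/
lemma sum_range_stable (h : ℕ → L) (h0 : h 0 = 0) (x : L) (n M M' : ℕ) (hM : n < M) (hM' : n < M')
    (c : PowerSeries ℚ) :
    ∑ k ∈ range M, coeff k c • K h x k n = ∑ k ∈ range M', coeff k c • K h x k n := by
  have aux : ∀ M, n < M → ∑ k ∈ range M, coeff k c • K h x k n
      = ∑ k ∈ range (n + 1), coeff k c • K h x k n := by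
    intro M hM
    symm
    refine sum_subset (by intro k; simp; omega) fun k _ hk => ?_
    rw [K_vanish h h0 x k n (by simpa using hk), smul_zero]
  rw [aux M hM, aux M' hM']

/-- the Euler operator on power series -/
noncomputable def euler (A : Type*) [Ring A] [Algebra ℚ A] :
    PowerSeries A →ₗ[ℚ] PowerSeries A where
  toFun p := PowerSeries.mk fun n => (n : ℚ) • coeff n p
  map_add' := by intro p q; ext1 n; simp
  map_smul' := by
    intro c p
    ext1 n
    have : ∀ (c : ℚ) (p : PowerSeries A), coeff n (c • p) = c • coeff n p := fun _ _ => rfl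
    simp only [this, coeff_mk, RingHom.id_apply]
    rw [smul_comm]

lemma coeff_euler {A : Type*} [Ring A] [Algebra ℚ A] (p : PowerSeries A) (n : ℕ) :
    coeff n (euler A p) = (n : ℚ) • coeff n p := by
  simp [euler]

lemma euler_mul {A : Type*} [Ring A] [Algebra ℚ A] (p q : PowerSeries A) :
    euler A (p * q) = euler A p * q + p * euler A q := by
  ext1 n
  rw [map_add, coeff_euler, coeff_mul, coeff_mul, coeff_mul, smul_sum, ← sum_add_distrib]
  refine sum_congr rfl fun u hu => ?_
  rw [coeff_euler, coeff_euler, smul_mul_assoc, mul_smul_comm, ← add_smul,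
    ← HasAntidiagonal.mem_antidiagonal.1 hu]
  push_cast; rfl

/-- the operator implementing the derivation in the first letter -/
noncomputable def dX : Module.End ℚ (L × ℚ) :=
  (LinearMap.inl ℚ L ℚ) ∘ₗ (der a10) ∘ₗ (LinearMap.fst ℚ L ℚ)

lemma dX_comm (l : L) : dX * rho a11 l - rho a11 l * dX = rho a11 (der a10 l) := by
  refine LinearMap.ext fun z => ?_
  simp only [LinearMap.sub_apply, Module.End.mul_apply, rho_apply]
  ext
  · simp [dX, der_lie, der_comm a10 a11]
    abel
  · simp [dX]

lemma total (H : ℕ → L) (h0 : H 0 = 0)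
    (hD : ∀ N : ℕ, ((N : ℚ) + 1) • H (N + 1)
      = ∑ k ∈ range (2 * N + 2), coeff k (bernoulliPowerSeries ℚ) •
            K H (FreeLieAlgebra.of ℚ true) k N
        + ∑ k ∈ range (2 * N + 2), coeff k (evalNegHom (bernoulliPowerSeries ℚ)) •
            K H (FreeLieAlgebra.of ℚ false) k N) (N : ℕ) :
    rho a11 (der a10 (H (N + 1))) = rho a11 (∑ k ∈ range (2 * N + 2),
      coeff k (bernoulliPowerSeries ℚ) • K H (FreeLieAlgebra.of ℚ true) k N) := by
  have hXI : ∀ x : L, C (rho a11 x) * X ∈ I (Module.End ℚ (L × ℚ)) 1 := by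
    intro x n hn
    obtain rfl : n = 0 := by omega
    simp
  have hH : ser H ∈ I (Module.End ℚ (L × ℚ)) 1 := by
    intro n hn
    obtain rfl : n = 0 := by omega
    simp [ser, h0]
  have hPc : ∀ p n, coeff n (adp (C dX) p) = dX * coeff n p - coeff n p * dX := by
    intro p n
    rw [adp_apply, map_sub, coeff_C_mul, coeff_mul_C]
  have key := core (A := Module.End ℚ (L × ℚ)) hH (hXI (FreeLieAlgebra.of ℚ true))
    (hXI (FreeLieAlgebra.of ℚ false)) (euler _) (adp (C dX)) euler_mul coeff_euler
    (by intro p q; simp only [adp_apply, sub_mul, mul_sub, mul_assoc]; abel)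
    (by
      intro M p hp n hn
      rw [hPc, hp n hn]; simp)
    (by
      intro p
      ext1 n
      rw [coeff_euler, hPc, hPc, coeff_euler, mul_smul_comm, smul_mul_assoc, smul_sub])
    (by
      ext1 n
      rw [coeff_euler]
      rcases n with _ | n
      · simp
      · rw [coeff_succ_mul_X, coeff_C]
        split_ifs with h
        · subst h; simp
        · simp)
    (by
      ext1 n
      rw [hPc]
      rcases n with _ | n
      · simp
      · rw [coeff_succ_mul_X, coeff_C]
        split_ifs
        · rw [dX_comm, der_of]; simp [a10]
        · simp)
    (by
      ext1 n
      rw [hPc]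
      rcases n with _ | n
      · simp
      · rw [coeff_succ_mul_X, coeff_C]
        split_ifs
        · rw [dX_comm, der_of]; simp [a10]
        · simp)
    (by
      intro M n hn
      rw [map_sub, map_add, coeff_euler]
      rcases n with _ | n
      · rw [coeff_ev_zero H h0, coeff_ev_zero H h0]; simp
      · rw [coeff_ev_succ, coeff_ev_succ, ser, coeff_mk, ← map_smul, ← map_add, ← map_sub]
        rw [sum_range_stable H h0 _ n M (2 * n + 2) (by omega) (by omega),
          sum_range_stable H h0 _ n M (2 * n + 2) (by omega) (by omega), ← hD]
        simp)
    (2 * N + 2) (N + 1) (by omega)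
  rw [map_sub, hPc, coeff_ev_succ, ser, coeff_mk, dX_comm, sub_eq_zero] at key
  exact key

lemma rho_inj (l : L) (c : ℚ) (hc : c ≠ 0) (hl : der a11 l = c • l) (h : rho a11 l = 0) : l = 0 := by
  have : der a11 l = 0 := by rw [der_apply, h]; rfl
  rw [hl] at this
  exact (smul_eq_zero.1 this).resolve_left hc

end Final

theorem main (G : ℕ × ℕ → L) (H : ℕ → L)
    (hHG : ∀ m, H m = ∑ q ∈ HasAntidiagonal.antidiagonal m, G q) (G0 : G 0 = 0)
    (hD : ∀ N : ℕ, ((N : ℚ) + 1) • H (N + 1)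
      = ∑ k ∈ range (2 * N + 2), coeff k (bernoulliPowerSeries ℚ) •
            K H (FreeLieAlgebra.of ℚ true) k N
        + ∑ k ∈ range (2 * N + 2), coeff k (evalNegHom (bernoulliPowerSeries ℚ)) •
            K H (FreeLieAlgebra.of ℚ false) k N)
    (d11 : ∀ p, der a11 (G p) = ((p.1 : ℚ) + p.2) • G p)
    (d10 : ∀ p, der a10 (G p) = (p.1 : ℚ) • G p) (w b : ℕ) :
    ((w : ℚ) + 1) • G (w + 1, b) = ∑ k ∈ range (2 * (w + b) + 2),
      coeff k (bernoulliPowerSeries ℚ) • K G (FreeLieAlgebra.of ℚ true) k (w, b) := by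
  have h0 : H 0 = 0 := by rw [hHG]; simp; exact G0
  obtain ⟨N, hN⟩ : ∃ N, N = w + b := ⟨_, rfl⟩
  set x : L := FreeLieAlgebra.of ℚ true with hx
  set c : ℕ × ℕ → L := fun p => ((p.1 : ℚ) + 1) • G (p.1 + 1, p.2) - ∑ k ∈ range (2 * N + 2),
      coeff k (bernoulliPowerSeries ℚ) • K G x k p with hc
  have dx11 : der a11 x = (1 : ℚ) • x := by rw [hx, der_of]; rfl
  have dx10 : der a10 x = (1 : ℚ) • x := by rw [hx, der_of]; rfl
  let ω11 : ℕ × ℕ →+ ℚ :=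
    { toFun := fun p => (p.1 : ℚ) + p.2
      map_zero' := by simp
      map_add' := by intro p q; simp; ring }
  let ω10 : ℕ × ℕ →+ ℚ :=
    { toFun := fun p => (p.1 : ℚ)
      map_zero' := by simp
      map_add' := by intro p q; simp }
  have c11 : ∀ p, der a11 (c p) = ((p.1 : ℚ) + p.2 + 1) • c p := by
    intro p
    simp only [hc]
    rw [map_sub, map_smul, d11, map_sum, smul_sub, smul_sum, smul_smul, smul_smul]
    congr 1
    · congr 1; push_cast; ring
    · refine sum_congr rfl fun k _ => ?_
      rw [map_smul, K_der G x a11 ω11 d11 1 dx11, smul_comm]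
      rfl
  have c10 : ∀ p, der a10 (c p) = ((p.1 + 1 : ℕ) : ℚ) • c p := by
    intro p
    simp only [hc]
    rw [map_sub, map_smul, d10, map_sum, smul_sub, smul_sum, smul_smul, smul_smul]
    congr 1
    · congr 1; push_cast; ring
    · refine sum_congr rfl fun k _ => ?_
      rw [map_smul, K_der G x a10 ω10 d10 1 dx10, smul_comm, Nat.cast_add, Nat.cast_one]
      rfl
  have csum : ∑ q ∈ HasAntidiagonal.antidiagonal N, c q
      = der a10 (H (N + 1)) - ∑ k ∈ range (2 * N + 2),
        coeff k (bernoulliPowerSeries ℚ) • K H x k N := by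
    simp only [hc]
    rw [sum_sub_distrib, sum_comm]
    congr 1
    · rw [hHG, map_sum, Finset.Nat.sum_antidiagonal_succ]
      simp only [d10]
      push_cast
      simp
    · refine sum_congr rfl fun k _ => ?_
      rw [K_split H G hHG, smul_sum]
  have czero : ∑ q ∈ HasAntidiagonal.antidiagonal N, c q = 0 := by
    refine rho_inj _ ((N : ℚ) + 1) (by positivity) ?_ ?_
    · rw [map_sum, smul_sum]
      refine sum_congr rfl fun q hq => ?_
      rw [c11, ← HasAntidiagonal.mem_antidiagonal.1 hq]
      push_cast; rfl
    · rw [csum, map_sub, total H h0 hD N, sub_self]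
  rw [Finset.Nat.sum_antidiagonal_eq_sum_range_succ_mk] at czero
  have h2 := indep (der a10) (Finset.Icc 1 (N + 1)) (fun i => c (i - 1, N - (i - 1)))
    (by
      intro i hi
      have : i - 1 + 1 = i := by simp at hi; omega
      rw [c10]; simp only [this])
    (by
      rw [← czero]
      refine sum_nbij' (fun i => i - 1) (fun i => i + 1) ?_ ?_ ?_ ?_ ?_
      · intro i hi; simp at *; omega
      · intro i hi; simp at *; omega
      · intro i hi; simp at *; omega
      · intro i hi; simp
      · intro i hi; rfl)
    (w + 1) (by simp; omega)
  have h3 : N - w = b := by omega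
  simp only [Nat.add_sub_cancel, h3, hc] at h2
  rw [sub_eq_zero] at h2
  rw [← hN]
  exact h2

end HausW


open scoped BigOperators

/-- the `w`-recursion for the bigraded components `H_{w,b}` of the
Hausdorff series (here `Hc w b`, pinned down by Dynkin's recursion for the total-degree
components `H P = Σ_{w+b=P} H_{w,b}` together with bihomogeneity):
`(w+1) H_{w+1,b} = (1/2)[X, H_{w,b}] + Σ_{r≥1} (B_{2r}/(2r)!) Σ [H_{w₁,b₁},[…,[H_{w_{2r},b_{2r}}, X]…]]`,
summed over tuples of nonzero bidegrees with `Σwᵢ = w`, `Σbᵢ = b`. -/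
theorem hausdorff_w_recursion
    (Hc : ℕ → ℕ → FreeLieAlgebra ℚ Bool)
    (H : ℕ → FreeLieAlgebra ℚ Bool)
    (X Y : FreeLieAlgebra ℚ Bool)
    (hX : X = FreeLieAlgebra.of ℚ true) (hY : Y = FreeLieAlgebra.of ℚ false)
    (hHsum : ∀ P : ℕ, H P = ∑ w ∈ Finset.range (P + 1), Hc w (P - w))
    (h1 : H 1 = X + Y)
    (hrec : ∀ N : ℕ, 1 ≤ N →
      ((N : ℚ) + 1) • H (N + 1)
        = (1 / 2 : ℚ) • ⁅X - Y, H N⁆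
          + ∑ r ∈ Finset.Icc 1 N,
              (bernoulli (2 * r) / (Nat.factorial (2 * r) : ℚ)) •
                ∑ s ∈ (Fintype.piFinset fun _ : Fin (2 * r) => Finset.range (N + 1)).filter
                    (fun s => (∀ i, 0 < s i) ∧ ∑ i, s i = N),
                  (List.ofFn s).foldr (fun m acc => ⁅H m, acc⁆) (X + Y))
    (hbihom : ∀ (w b : ℕ) (s t : ℚ),
      (FreeLieAlgebra.lift ℚ (fun i : Bool => (if i then s else t) • FreeLieAlgebra.of ℚ i))
          (Hc w b)
        = (s ^ w * t ^ b) • Hc w b)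
    :
    ∀ w b : ℕ, 1 ≤ w + b →
      ((w : ℚ) + 1) • Hc (w + 1) b
        = (1 / 2 : ℚ) • ⁅X, Hc w b⁆
          + ∑ r ∈ Finset.Icc 1 (w + b),
              (bernoulli (2 * r) / (Nat.factorial (2 * r) : ℚ)) •
                ∑ wb ∈ (Fintype.piFinset fun _ : Fin (2 * r) =>
                      Finset.range (w + 1) ×ˢ Finset.range (b + 1)).filter
                    (fun wb => (∀ i, wb i ≠ (0, 0)) ∧ (∑ i, (wb i).1) = w
                      ∧ (∑ i, (wb i).2) = b),
                  (List.ofFn wb).foldr (fun p acc => ⁅Hc p.1 p.2, acc⁆) X := by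
  subst hX hY
  intro w b hwb
  set G : ℕ × ℕ → HausW.L := fun p => Hc p.1 p.2 with hG
  have G0 : G 0 = 0 := by
    have h := hbihom 0 0 0 0
    have h2 : ∀ l : HausW.L, (FreeLieAlgebra.lift ℚ
        (fun i : Bool => (if i then (0 : ℚ) else 0) • FreeLieAlgebra.of ℚ i)) l = 0 := by
      intro l
      induction l using HausW.free_induction with
      | h0 => simp
      | hadd p q hp hq => rw [map_add, hp, hq, add_zero]
      | hsmul c p hp => rw [map_smul, hp, smul_zero]
      | hlie p q hp hq => rw [LieHom.map_lie, hp, zero_lie]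
      | hof i => rw [FreeLieAlgebra.lift_of_apply]; simp
    rw [h2] at h
    have h3 : Hc 0 0 = 0 := by simpa using h.symm
    exact h3
  have hHG : ∀ m, H m = ∑ q ∈ Finset.HasAntidiagonal.antidiagonal m, G q := by
    intro m
    rw [hHsum, Finset.Nat.sum_antidiagonal_eq_sum_range_succ_mk]
  have h0 : H 0 = 0 := by
    have h3 : Hc 0 0 = 0 := G0
    rw [hHsum]
    simpa using h3
  have d11 : ∀ p, HausW.der HausW.a11 (G p) = ((p.1 : ℚ) + p.2) • G p := by
    intro p
    have h := HausW.der_of_sigma (fun _ => 1) (FreeLieAlgebra.lift ℚ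
        (fun i : Bool => (if i then (2 : ℚ) else 2) • FreeLieAlgebra.of ℚ i)) (by
      intro i
      rw [FreeLieAlgebra.lift_of_apply]
      cases i <;> simp) (G p) (p.1 + p.2) (by
        rw [pow_add]; exact hbihom p.1 p.2 2 2)
    rw [Nat.cast_add] at h
    rw [← h]
    have e : HausW.a11 = fun _ => ((1 : ℕ) : ℚ) := by funext i; simp [HausW.a11]
    rw [e]
  have d10 : ∀ p, HausW.der HausW.a10 (G p) = (p.1 : ℚ) • G p := by
    intro p
    have h := HausW.der_of_sigma (fun i => if i then 1 else 0) (FreeLieAlgebra.lift ℚ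
        (fun i : Bool => (if i then (2 : ℚ) else 1) • FreeLieAlgebra.of ℚ i)) (by
      intro i
      rw [FreeLieAlgebra.lift_of_apply]
      cases i <;> simp) (G p) p.1 (by
        have h5 := hbihom p.1 p.2 2 1
        rw [one_pow, mul_one] at h5
        exact h5)
    rw [← h]
    have e : HausW.a10 = fun i => ((if i then 1 else 0 : ℕ) : ℚ) := by
      funext i; cases i <;> simp [HausW.a10]
    rw [e]
  have hD : ∀ N : ℕ, ((N : ℚ) + 1) • H (N + 1)
      = ∑ k ∈ Finset.range (2 * N + 2), PowerSeries.coeff k (bernoulliPowerSeries ℚ) •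
            HausW.K H (FreeLieAlgebra.of ℚ true) k N
        + ∑ k ∈ Finset.range (2 * N + 2),
            PowerSeries.coeff k (PowerSeries.evalNegHom (bernoulliPowerSeries ℚ)) •
            HausW.K H (FreeLieAlgebra.of ℚ false) k N := by
    intro N
    rw [HausW.evenodd, HausW.evenodd_neg, HausW.K_one, HausW.K_one]
    rcases Nat.eq_zero_or_pos N with rfl | hN
    · simp [h0, h1, HausW.K]
    · rw [hrec N hN]
      have hK0 : ∀ x, HausW.K H x 0 N = 0 := by
        intro x
        simp only [HausW.K]
        rw [if_neg (by omega)]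
      have e : ∀ r ∈ Finset.Icc 1 N, (bernoulli (2 * r) / (Nat.factorial (2 * r) : ℚ)) •
                ∑ s ∈ (Fintype.piFinset fun _ : Fin (2 * r) => Finset.range (N + 1)).filter
                    (fun s => (∀ i, 0 < s i) ∧ ∑ i, s i = N),
                  (List.ofFn s).foldr (fun m acc => ⁅H m, acc⁆)
                    (FreeLieAlgebra.of ℚ true + FreeLieAlgebra.of ℚ false)
          = (bernoulli (2 * r) / (Nat.factorial (2 * r) : ℚ)) •
              HausW.K H (FreeLieAlgebra.of ℚ true) (2 * r) N
            + (bernoulli (2 * r) / (Nat.factorial (2 * r) : ℚ)) •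
              HausW.K H (FreeLieAlgebra.of ℚ false) (2 * r) N := by
        intro r _
        rw [HausW.K_filter H h0 _ (2 * r) N, HausW.K_add, smul_add]
        intro s
        simp only [Finset.mem_filter, Fintype.mem_piFinset, Finset.mem_range]
        constructor
        · rintro ⟨_, h, h'⟩
          exact ⟨fun i => (h i).ne', h'⟩
        · rintro ⟨h, h'⟩
          refine ⟨fun i => ?_, fun i => Nat.pos_of_ne_zero (h i), h'⟩
          have := Finset.single_le_sum (f := s) (fun _ _ => Nat.zero_le _) (Finset.mem_univ i)
          omega
      rw [Finset.sum_congr rfl e, Finset.sum_add_distrib, hK0, hK0, sub_lie, smul_sub,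
        ← lie_skew (FreeLieAlgebra.of ℚ true) (H N),
        ← lie_skew (FreeLieAlgebra.of ℚ false) (H N), smul_neg, smul_neg]
      abel
  have hm := HausW.main G H hHG G0 hD d11 d10 w b
  rw [HausW.evenodd, HausW.K_one] at hm
  have hK0 : HausW.K G (FreeLieAlgebra.of ℚ true) 0 (w, b) = 0 := by
    simp only [HausW.K]
    rw [if_neg]
    intro h
    simp only [Prod.mk_eq_zero] at h
    omega
  rw [hK0, zero_sub, ← smul_neg, lie_skew] at hm
  refine hm.trans ?_
  congr 1
  refine Finset.sum_congr rfl fun r _ => ?_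
  congr 1
  symm
  refine HausW.K_filter G G0 _ (2 * r) (w, b) _ ?_
  intro s
  simp only [Finset.mem_filter, Fintype.mem_piFinset, Finset.mem_product, Finset.mem_range]
  have hsum : ∑ i, s i = (w, b) ↔ (∑ i, (s i).1) = w ∧ (∑ i, (s i).2) = b := by
    rw [Prod.ext_iff, Prod.fst_sum, Prod.snd_sum]
  rw [hsum]
  constructor
  · rintro ⟨_, h⟩
    exact h
  · rintro ⟨h, h', h''⟩
    refine ⟨fun i => ?_, h, h', h''⟩
    have e1 := Finset.single_le_sum (f := fun i => (s i).1) (fun _ _ => Nat.zero_le _)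
      (Finset.mem_univ i)
    have e2 := Finset.single_le_sum (f := fun i => (s i).2) (fun _ _ => Nat.zero_le _)
      (Finset.mem_univ i)
    omega
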